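/- Let T : ℋⁿ → ℋⁿ be an ℝ-linear map with least vector q = (q₁,…,q_n). Then q₁ = max{‖T‖_∞, ‖T*‖_∞}, where ‖T‖_∞ = sup over nonzero X ∈ ℋⁿ of ‖T(X)‖_∞/‖X‖_∞ and ‖X‖_∞ = λ₁(|X|) is the largest absolute value of an eigenvalue of X. -/

import Mathlib

open Matrix
open scoped ComplexOrder

/-- Sum of the `k` largest entries of `p` (as a supremum of sums over `k`-subsets). -/
noncomputable def sumLargest {n : ℕ} (p : Fin n → ℝ) (k : ℕ) : ℝ :=
  sSup ((fun A : Finset (Fin n) => ∑ i ∈ A, p i) '' {A : Finset (Fin n) | A.card = k})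

/-- `p` is weakly majorized by `q`. -/
def WeakMaj {n : ℕ} (p q : Fin n → ℝ) : Prop :=
  ∀ k : ℕ, 1 ≤ k → k ≤ n → sumLargest p k ≤ sumLargest q k

/-- `p` is majorized by `q`. -/
def Maj {n : ℕ} (p q : Fin n → ℝ) : Prop :=
  WeakMaj p q ∧ ∑ i, p i = ∑ i, q i

/-- `p` has nonnegative entries arranged in decreasing order. -/
def DecrNonneg {n : ℕ} (p : Fin n → ℝ) : Prop :=
  Antitone p ∧ ∀ i, 0 ≤ p i

/-- The decreasing rearrangement of a vector. -/
noncomputable def decrRearrange {n : ℕ} (p : Fin n → ℝ) : Fin n → ℝ :=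
  fun i => p (Tuple.sort p (Fin.rev i))

/-- `x` is the supremum of `S` in the weak-majorization order (w-sup). -/
def IsWSup {n : ℕ} (S : Set (Fin n → ℝ)) (x : Fin n → ℝ) : Prop :=
  DecrNonneg x ∧ (∀ s ∈ S, WeakMaj s x) ∧
    ∀ p : Fin n → ℝ, (∀ i, 0 ≤ p i) → (∀ s ∈ S, WeakMaj s p) → WeakMaj x p

/-- `x` is the infimum of `Q` in the weak-majorization order (w-inf). -/
def IsWInf {n : ℕ} (Q : Set (Fin n → ℝ)) (x : Fin n → ℝ) : Prop :=
  DecrNonneg x ∧ (∀ q ∈ Q, WeakMaj x q) ∧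
    ∀ p : Fin n → ℝ, (∀ i, 0 ≤ p i) → (∀ q ∈ Q, WeakMaj p q) → WeakMaj p x

open Classical in
/-- The vector of eigenvalues of a Hermitian matrix, in decreasing order
(junk value `0` if the matrix is not Hermitian). -/
noncomputable def specVec {n : ℕ} (X : Matrix (Fin n) (Fin n) ℂ) : Fin n → ℝ :=
  if h : X.IsHermitian then decrRearrange h.eigenvalues else 0

open Classical in
/-- `λ(|X|)`: the absolute values of the eigenvalues of a Hermitian matrix `X`,
in decreasing order. -/
noncomputable def absSpecVec {n : ℕ} (X : Matrix (Fin n) (Fin n) ℂ) : Fin n → ℝ :=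
  if h : X.IsHermitian then decrRearrange (fun i => |h.eigenvalues i|) else 0

/-- The Jordan product `X ∘ Y = (XY + YX)/2`. -/
noncomputable def jmul {n : ℕ} (X Y : Matrix (Fin n) (Fin n) ℂ) : Matrix (Fin n) (Fin n) ℂ :=
  (2 : ℂ)⁻¹ • (X * Y + Y * X)

/-- A nonzero (orthogonal) projection in `ℋⁿ`. -/
def IsProjection {n : ℕ} (P : Matrix (Fin n) (Fin n) ℂ) : Prop :=
  P.IsHermitian ∧ P * P = P ∧ P ≠ 0

/-- An involution in `ℋⁿ`: a Hermitian matrix with `ε² = I`. -/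
def IsInvolution {n : ℕ} (ε : Matrix (Fin n) (Fin n) ℂ) : Prop :=
  ε.IsHermitian ∧ ε * ε = 1

/-- A positive map: maps positive semidefinite matrices to positive semidefinite matrices. -/
def PositiveMap {n : ℕ} (T : Matrix (Fin n) (Fin n) ℂ → Matrix (Fin n) (Fin n) ℂ) : Prop :=
  ∀ X : Matrix (Fin n) (Fin n) ℂ, X.PosSemidef → (T X).PosSemidef

/-- `S` is the adjoint of `T` with respect to the trace inner product on `ℋⁿ`. -/
def IsAdjointOf {n : ℕ} (S T : Matrix (Fin n) (Fin n) ℂ → Matrix (Fin n) (Fin n) ℂ) : Prop :=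
  ∀ X Y : Matrix (Fin n) (Fin n) ℂ, X.IsHermitian → Y.IsHermitian →
    Matrix.trace (T X * Y) = Matrix.trace (X * S Y)

/-- `q` is the least vector of `T`: `λ(|T(X)|) ≺_w q * λ(|X|)` for all Hermitian `X`,
and `q ≺_w q'` for any other `q' ∈ (ℝⁿ₊)↓` with the same property. -/
def IsLeastVector {n : ℕ} (T : Matrix (Fin n) (Fin n) ℂ → Matrix (Fin n) (Fin n) ℂ)
    (q : Fin n → ℝ) : Prop :=
  DecrNonneg q ∧
  (∀ X : Matrix (Fin n) (Fin n) ℂ, X.IsHermitian →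
    WeakMaj (absSpecVec (T X)) (q * absSpecVec X)) ∧
  ∀ q' : Fin n → ℝ, DecrNonneg q' →
    (∀ X : Matrix (Fin n) (Fin n) ℂ, X.IsHermitian →
      WeakMaj (absSpecVec (T X)) (q' * absSpecVec X)) → WeakMaj q q'

section SumLargest

variable {n : ℕ}

theorem sum_le_sumLargest (p : Fin n → ℝ) (A : Finset (Fin n)) :
    ∑ i ∈ A, p i ≤ sumLargest p A.card :=
  le_csSup (Set.toFinite _).bddAbove ⟨A, rfl, rfl⟩

theorem sumLargest_le {p : Fin n → ℝ} {k : ℕ} {c : ℝ} (hk : k ≤ n)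
    (h : ∀ A : Finset (Fin n), A.card = k → ∑ i ∈ A, p i ≤ c) : sumLargest p k ≤ c := by
  obtain ⟨A, -, hA⟩ := Finset.exists_subset_card_eq
    (s := (Finset.univ : Finset (Fin n))) (n := k) (by simpa using hk)
  refine csSup_le ⟨_, A, hA, rfl⟩ ?_
  rintro _ ⟨B, hB, rfl⟩
  exact h B hB

theorem le_sumLargest_one (p : Fin n → ℝ) (i : Fin n) : p i ≤ sumLargest p 1 := by
  simpa using sum_le_sumLargest p {i}

theorem sumLargest_one_le {p : Fin n → ℝ} {c : ℝ} (hn : 0 < n) (h : ∀ i, p i ≤ c) :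
    sumLargest p 1 ≤ c := by
  refine sumLargest_le hn fun A hA => ?_
  obtain ⟨i, rfl⟩ := Finset.card_eq_one.mp hA
  simpa using h i

theorem sumLargest_card_eq_sum (p : Fin n → ℝ) : sumLargest p n = ∑ i, p i := by
  refine le_antisymm (sumLargest_le le_rfl fun A hA => ?_) ?_
  · rw [Finset.card_eq_iff_eq_univ A |>.mp (by simpa using hA)]
  · simpa using sum_le_sumLargest p Finset.univ

end SumLargest

section UnitaryConj

variable {n : ℕ}

/-- The Hermitian matrix with eigenvalues `d` in the orthonormal basis of columns of `U`. -/
noncomputable def unitaryConj (U : Matrix (Fin n) (Fin n) ℂ) (d : Fin n → ℝ) :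
    Matrix (Fin n) (Fin n) ℂ :=
  U * diagonal (fun i => (d i : ℂ)) * Uᴴ

/-- The value of the quadratic form of `X` at the `i`-th column of `W`. -/
noncomputable def columnForm (W X : Matrix (Fin n) (Fin n) ℂ) (i : Fin n) : ℝ :=
  ((Wᴴ * X * W) i i).re

theorem isHermitian_unitaryConj (U : Matrix (Fin n) (Fin n) ℂ) (d : Fin n → ℝ) :
    (unitaryConj U d).IsHermitian := by
  refine isHermitian_mul_mul_conjTranspose U (isHermitian_diagonal_iff.mpr fun i => ?_)
  simp [isSelfAdjoint_iff]

theorem unitaryConj_add (U : Matrix (Fin n) (Fin n) ℂ) (d e : Fin n → ℝ) :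
    unitaryConj U (d + e) = unitaryConj U d + unitaryConj U e := by
  simp [unitaryConj, ← diagonal_add, Matrix.mul_add, Matrix.add_mul]

theorem unitaryConj_zero (U : Matrix (Fin n) (Fin n) ℂ) : unitaryConj U 0 = 0 := by
  simp [unitaryConj]

theorem columnForm_add (W X Y : Matrix (Fin n) (Fin n) ℂ) (i : Fin n) :
    columnForm W (X + Y) i = columnForm W X i + columnForm W Y i := by
  simp [columnForm, Matrix.mul_add, Matrix.add_mul]

theorem re_trace_unitaryConj_mul (U Y : Matrix (Fin n) (Fin n) ℂ) (d : Fin n → ℝ) :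
    (trace (unitaryConj U d * Y)).re = ∑ i, d i * columnForm U Y i := by
  have h : trace (unitaryConj U d * Y)
      = trace (diagonal (fun i => (d i : ℂ)) * (Uᴴ * Y * U)) := by
    rw [unitaryConj, Matrix.mul_assoc, Matrix.mul_assoc, trace_mul_comm]
    simp only [Matrix.mul_assoc]
  rw [h]
  simp [trace, diagonal_mul, columnForm]

theorem columnForm_unitaryConj (W U : Matrix (Fin n) (Fin n) ℂ) (d : Fin n → ℝ) (j : Fin n) :
    columnForm W (unitaryConj U d) j = ∑ i, d i * Complex.normSq ((Wᴴ * U) j i) := by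
  have h : Wᴴ * unitaryConj U d * W
      = (Wᴴ * U) * diagonal (fun i => (d i : ℂ)) * (Wᴴ * U)ᴴ := by
    simp [unitaryConj, Matrix.mul_assoc]
  rw [columnForm, h, mul_apply, Complex.re_sum]
  refine Finset.sum_congr rfl fun i _ => ?_
  rw [mul_diagonal, conjTranspose_apply, mul_right_comm, Complex.star_def, Complex.mul_conj,
    ← Complex.ofReal_mul, Complex.ofReal_re, mul_comm]

theorem sum_normSq_row {V : Matrix (Fin n) (Fin n) ℂ} (hV : V * Vᴴ = 1) (j : Fin n) :
    ∑ i, Complex.normSq (V j i) = 1 := by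
  have h := congrArg Complex.re (congrFun (congrFun hV j) j)
  simpa [mul_apply, Complex.mul_conj] using h

theorem sum_normSq_col {V : Matrix (Fin n) (Fin n) ℂ} (hV : Vᴴ * V = 1) (i : Fin n) :
    ∑ j, Complex.normSq (V j i) = 1 := by
  have h := congrArg Complex.re (congrFun (congrFun hV i) i)
  simpa [mul_apply, ← Complex.normSq_eq_conj_mul_self] using h

theorem conjTranspose_mul_mem_unitaryGroup {U W : Matrix (Fin n) (Fin n) ℂ}
    (hW : W ∈ unitaryGroup (Fin n) ℂ) (hU : U ∈ unitaryGroup (Fin n) ℂ) :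
    Wᴴ * U ∈ unitaryGroup (Fin n) ℂ :=
  mul_mem (Unitary.star_mem hW) hU

theorem abs_columnForm_unitaryConj_le {U W : Matrix (Fin n) (Fin n) ℂ}
    (hW : W ∈ unitaryGroup (Fin n) ℂ) (hU : U ∈ unitaryGroup (Fin n) ℂ)
    {d : Fin n → ℝ} {c : ℝ} (hd : ∀ i, |d i| ≤ c) (j : Fin n) :
    |columnForm W (unitaryConj U d) j| ≤ c := by
  have hV := conjTranspose_mul_mem_unitaryGroup hW hU
  rw [columnForm_unitaryConj]
  calc |∑ i, d i * Complex.normSq ((Wᴴ * U) j i)|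
      ≤ ∑ i, |d i * Complex.normSq ((Wᴴ * U) j i)| := Finset.abs_sum_le_sum_abs _ _
    _ ≤ ∑ i, c * Complex.normSq ((Wᴴ * U) j i) := by
        refine Finset.sum_le_sum fun i _ => ?_
        rw [abs_mul, abs_of_nonneg (Complex.normSq_nonneg _)]
        exact mul_le_mul_of_nonneg_right (hd i) (Complex.normSq_nonneg _)
    _ = c := by
        rw [← Finset.mul_sum, sum_normSq_row (mem_unitaryGroup_iff.mp hV), mul_one]

theorem sum_abs_columnForm_unitaryConj_le {U W : Matrix (Fin n) (Fin n) ℂ}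
    (hW : W ∈ unitaryGroup (Fin n) ℂ) (hU : U ∈ unitaryGroup (Fin n) ℂ) (d : Fin n → ℝ) :
    ∑ j, |columnForm W (unitaryConj U d) j| ≤ ∑ i, |d i| := by
  have hV := conjTranspose_mul_mem_unitaryGroup hW hU
  calc ∑ j, |columnForm W (unitaryConj U d) j|
      ≤ ∑ j, ∑ i, |d i| * Complex.normSq ((Wᴴ * U) j i) := by
        refine Finset.sum_le_sum fun j _ => ?_
        rw [columnForm_unitaryConj]
        refine (Finset.abs_sum_le_sum_abs _ _).trans_eq (Finset.sum_congr rfl fun i _ => ?_)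
        rw [abs_mul, abs_of_nonneg (Complex.normSq_nonneg _)]
    _ = ∑ i, |d i| := by
        rw [Finset.sum_comm]
        refine Finset.sum_congr rfl fun i _ => ?_
        rw [← Finset.mul_sum, sum_normSq_col (mem_unitaryGroup_iff'.mp hV), mul_one]

theorem columnForm_unitaryConj_self {U : Matrix (Fin n) (Fin n) ℂ}
    (hU : U ∈ unitaryGroup (Fin n) ℂ) (d : Fin n → ℝ) (j : Fin n) :
    columnForm U (unitaryConj U d) j = d j := by
  rw [columnForm_unitaryConj, show Uᴴ * U = 1 from mem_unitaryGroup_iff'.mp hU,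
    Finset.sum_eq_single j] <;> simp +contextual [one_apply, eq_comm]

end UnitaryConj

section AbsSpecVec

variable {n : ℕ}

theorem Matrix.submatrix_id_equiv_mem_unitaryGroup {U : Matrix (Fin n) (Fin n) ℂ}
    (hU : U ∈ unitaryGroup (Fin n) ℂ) (σ : Equiv.Perm (Fin n)) :
    U.submatrix id σ ∈ unitaryGroup (Fin n) ℂ := by
  rw [mem_unitaryGroup_iff, star_eq_conjTranspose, conjTranspose_submatrix, submatrix_mul_equiv,
    ← star_eq_conjTranspose, mem_unitaryGroup_iff.mp hU]
  simp

theorem decrRearrange_antitone (p : Fin n → ℝ) : Antitone (decrRearrange p) := fun _ _ h =>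
  Tuple.monotone_sort p (Fin.rev_le_rev.mpr h)

/-- Spectral theorem, with the eigenvalues ordered by decreasing absolute value. -/
theorem exists_unitaryConj {X : Matrix (Fin n) (Fin n) ℂ} (hX : X.IsHermitian) :
    ∃ U ∈ unitaryGroup (Fin n) ℂ, ∃ d : Fin n → ℝ,
      X = unitaryConj U d ∧ ∀ i, absSpecVec X i = |d i| := by
  set σ : Equiv.Perm (Fin n) := Fin.revPerm.trans (Tuple.sort fun i => |hX.eigenvalues i|)
  set U : Matrix (Fin n) (Fin n) ℂ := hX.eigenvectorUnitary.1
  have hU : U ∈ unitaryGroup (Fin n) ℂ := hX.eigenvectorUnitary.2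
  refine ⟨U.submatrix id σ, submatrix_id_equiv_mem_unitaryGroup hU σ,
    hX.eigenvalues ∘ σ, ?_, fun i => ?_⟩
  · have h : X = U * diagonal (fun i => (hX.eigenvalues i : ℂ)) * Uᴴ := by
      conv_lhs => rw [hX.spectral_theorem]
      rfl
    have hd : diagonal (fun i => (((hX.eigenvalues ∘ σ) i : ℝ) : ℂ))
        = (diagonal fun i => (hX.eigenvalues i : ℂ)).submatrix σ σ := by
      rw [submatrix_diagonal_equiv]; rfl
    rw [unitaryConj, hd, conjTranspose_submatrix, submatrix_mul_equiv, submatrix_mul_equiv, ← h,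
      submatrix_id_id]
  · rw [absSpecVec, dif_pos hX]
    rfl

theorem absSpecVec_antitone (X : Matrix (Fin n) (Fin n) ℂ) : Antitone (absSpecVec X) := by
  unfold absSpecVec
  split_ifs
  · exact decrRearrange_antitone _
  · exact antitone_const

theorem absSpecVec_nonneg {X : Matrix (Fin n) (Fin n) ℂ} (hX : X.IsHermitian) (i : Fin n) :
    0 ≤ absSpecVec X i := by
  obtain ⟨U, -, d, -, h⟩ := exists_unitaryConj hX
  exact h i ▸ abs_nonneg _

theorem absSpecVec_le_zero_index (hn : 0 < n) (X : Matrix (Fin n) (Fin n) ℂ) (i : Fin n) :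
    absSpecVec X i ≤ absSpecVec X ⟨0, hn⟩ :=
  absSpecVec_antitone X (Fin.mk_le_of_le_val (Nat.zero_le _))

theorem absSpecVec_unitaryConj_le {U : Matrix (Fin n) (Fin n) ℂ}
    (hU : U ∈ unitaryGroup (Fin n) ℂ) {d : Fin n → ℝ} {c : ℝ} (hd : ∀ i, |d i| ≤ c)
    (j : Fin n) : absSpecVec (unitaryConj U d) j ≤ c := by
  obtain ⟨W, hW, e, hWe, h⟩ := exists_unitaryConj (isHermitian_unitaryConj U d)
  rw [h, ← columnForm_unitaryConj_self hW e j, ← hWe]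
  exact abs_columnForm_unitaryConj_le hW hU hd j

theorem sum_absSpecVec_unitaryConj_le {U : Matrix (Fin n) (Fin n) ℂ}
    (hU : U ∈ unitaryGroup (Fin n) ℂ) (d : Fin n → ℝ) :
    ∑ j, absSpecVec (unitaryConj U d) j ≤ ∑ i, |d i| := by
  obtain ⟨W, hW, e, hWe, h⟩ := exists_unitaryConj (isHermitian_unitaryConj U d)
  refine le_trans (le_of_eq (Finset.sum_congr rfl fun j _ => ?_))
    (sum_abs_columnForm_unitaryConj_le hW hU d)
  rw [h, hWe, columnForm_unitaryConj_self hW]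

theorem abs_columnForm_le (hn : 0 < n) {W X : Matrix (Fin n) (Fin n) ℂ}
    (hW : W ∈ unitaryGroup (Fin n) ℂ) (hX : X.IsHermitian) (j : Fin n) :
    |columnForm W X j| ≤ absSpecVec X ⟨0, hn⟩ := by
  obtain ⟨U, hU, d, hd, h⟩ := exists_unitaryConj hX
  have hc : ∀ i, |d i| ≤ absSpecVec X ⟨0, hn⟩ := fun i => h i ▸ absSpecVec_le_zero_index hn X i
  have := abs_columnForm_unitaryConj_le hW hU hc j
  rwa [← hd] at this

theorem sum_abs_columnForm_le {W X : Matrix (Fin n) (Fin n) ℂ}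
    (hW : W ∈ unitaryGroup (Fin n) ℂ) (hX : X.IsHermitian) :
    ∑ j, |columnForm W X j| ≤ ∑ j, absSpecVec X j := by
  obtain ⟨U, hU, d, hd, h⟩ := exists_unitaryConj hX
  have := sum_abs_columnForm_unitaryConj_le hW hU d
  rw [← hd] at this
  simpa only [h] using this

theorem absSpecVec_zero (j : Fin n) : absSpecVec (0 : Matrix (Fin n) (Fin n) ℂ) j = 0 := by
  refine le_antisymm ?_ (absSpecVec_nonneg isHermitian_zero j)
  have := absSpecVec_unitaryConj_le (one_mem (unitaryGroup (Fin n) ℂ)) (d := 0) (c := 0)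
    (by simp) j
  rwa [unitaryConj_zero] at this

theorem absSpecVec_pos (hn : 0 < n) {X : Matrix (Fin n) (Fin n) ℂ} (hX : X.IsHermitian)
    (h0 : X ≠ 0) : 0 < absSpecVec X ⟨0, hn⟩ := by
  refine lt_of_le_of_ne (absSpecVec_nonneg hX _) fun h => h0 ?_
  obtain ⟨U, hU, d, hd, hs⟩ := exists_unitaryConj hX
  have : d = 0 := funext fun i => abs_eq_zero.mp <| le_antisymm
    (hs i ▸ h ▸ absSpecVec_le_zero_index hn X i) (abs_nonneg _)
  rw [hd, this, unitaryConj_zero]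

/-- Trace-norm/operator-norm Hölder inequality. -/
theorem re_trace_mul_le (hn : 0 < n) {X Y : Matrix (Fin n) (Fin n) ℂ} (hX : X.IsHermitian)
    (hY : Y.IsHermitian) :
    (trace (X * Y)).re ≤ (∑ i, absSpecVec X i) * absSpecVec Y ⟨0, hn⟩ := by
  obtain ⟨U, hU, d, hd, h⟩ := exists_unitaryConj hX
  simp only [h]
  rw [hd, re_trace_unitaryConj_mul, Finset.sum_mul]
  refine Finset.sum_le_sum fun i _ => (le_abs_self _).trans ?_
  rw [abs_mul]
  exact mul_le_mul_of_nonneg_left (abs_columnForm_le hn hU hY i) (abs_nonneg _)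

/-- The spectral-norm bound for `S` dualizes to a trace-norm bound for its adjoint `T`. -/
theorem sum_absSpecVec_le_of_adjoint (hn : 0 < n)
    {T S : Matrix (Fin n) (Fin n) ℂ → Matrix (Fin n) (Fin n) ℂ}
    (hT : ∀ X, X.IsHermitian → (T X).IsHermitian) (hS : ∀ X, X.IsHermitian → (S X).IsHermitian)
    (hadj : IsAdjointOf S T) {c : ℝ} (hc : 0 ≤ c)
    (h : ∀ X : Matrix (Fin n) (Fin n) ℂ, X.IsHermitian →
      absSpecVec (S X) ⟨0, hn⟩ ≤ c * absSpecVec X ⟨0, hn⟩)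
    {X : Matrix (Fin n) (Fin n) ℂ} (hX : X.IsHermitian) :
    ∑ i, absSpecVec (T X) i ≤ c * ∑ i, absSpecVec X i := by
  obtain ⟨W, hW, e, he, hs⟩ := exists_unitaryConj (hT X hX)
  set s : Fin n → ℝ := fun i => SignType.sign (e i)
  have hs1 : ∀ i, |s i| ≤ 1 := fun i => by
    rcases lt_trichotomy (e i) 0 with hi | hi | hi <;> simp [s, hi]
  have hY := isHermitian_unitaryConj W s
  calc ∑ i, absSpecVec (T X) i = ∑ i, s i * columnForm W (T X) i := by
        refine Finset.sum_congr rfl fun i _ => ?_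
        rw [hs, he, columnForm_unitaryConj_self hW]
        exact (sign_mul_self (e i)).symm
    _ = (trace (X * S (unitaryConj W s))).re := by
        rw [← hadj X _ hX hY, trace_mul_comm, re_trace_unitaryConj_mul]
    _ ≤ (∑ i, absSpecVec X i) * absSpecVec (S (unitaryConj W s)) ⟨0, hn⟩ :=
        re_trace_mul_le hn hX (hS _ hY)
    _ ≤ (∑ i, absSpecVec X i) * c := by
        refine mul_le_mul_of_nonneg_left ((h _ hY).trans ?_)
          (Finset.sum_nonneg fun i _ => absSpecVec_nonneg hX i)
        exact mul_le_of_le_one_right hc (absSpecVec_unitaryConj_le hW hs1 _)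
    _ = c * ∑ i, absSpecVec X i := mul_comm _ _

/-- The trace-norm bound for `T` dualizes to a spectral-norm bound for its adjoint `S`. -/
theorem absSpecVec_le_of_adjoint (hn : 0 < n)
    {T S : Matrix (Fin n) (Fin n) ℂ → Matrix (Fin n) (Fin n) ℂ}
    (hT : ∀ X, X.IsHermitian → (T X).IsHermitian) (hS : ∀ X, X.IsHermitian → (S X).IsHermitian)
    (hadj : IsAdjointOf S T) {c : ℝ} (hc : 0 ≤ c)
    (h : ∀ X : Matrix (Fin n) (Fin n) ℂ, X.IsHermitian →
      ∑ i, absSpecVec (T X) i ≤ c * ∑ i, absSpecVec X i)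
    {X : Matrix (Fin n) (Fin n) ℂ} (hX : X.IsHermitian) :
    absSpecVec (S X) ⟨0, hn⟩ ≤ c * absSpecVec X ⟨0, hn⟩ := by
  obtain ⟨W, hW, e, he, hs⟩ := exists_unitaryConj (hS X hX)
  set s : Fin n → ℝ := Pi.single ⟨0, hn⟩ (SignType.sign (e ⟨0, hn⟩) : ℝ)
  have hs1 : ∑ i, |s i| ≤ 1 := by
    rw [Finset.sum_eq_single ⟨0, hn⟩ (by simp +contextual [s]) (by simp)]
    rcases lt_trichotomy (e ⟨0, hn⟩) 0 with hi | hi | hi <;> simp [s, hi]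
  have hY := isHermitian_unitaryConj W s
  calc absSpecVec (S X) ⟨0, hn⟩ = ∑ i, s i * columnForm W (S X) i := by
        rw [Finset.sum_eq_single ⟨0, hn⟩ (by simp +contextual [s]) (by simp), hs, he,
          columnForm_unitaryConj_self hW]
        simp [s]
    _ = (trace (T (unitaryConj W s) * X)).re := by
        rw [hadj _ X hY hX, re_trace_unitaryConj_mul]
    _ ≤ (∑ i, absSpecVec (T (unitaryConj W s)) i) * absSpecVec X ⟨0, hn⟩ :=
        re_trace_mul_le hn (hT _ hY) hX
    _ ≤ c * absSpecVec X ⟨0, hn⟩ := by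
        refine mul_le_mul_of_nonneg_right ((h _ hY).trans ?_) (absSpecVec_nonneg hX _)
        exact mul_le_of_le_one_right hc ((sum_absSpecVec_unitaryConj_le hW s).trans hs1)

/-- A Hermitian matrix splits as `Y + Z` with `‖Y‖₁ + k ‖Z‖_∞` at most its `k`-th Ky Fan norm. -/
theorem exists_add_eq_kyFan (hn : 0 < n) {X : Matrix (Fin n) (Fin n) ℂ} (hX : X.IsHermitian)
    {k : ℕ} (hk : 1 ≤ k) (hkn : k ≤ n) :
    ∃ Y Z : Matrix (Fin n) (Fin n) ℂ, Y.IsHermitian ∧ Z.IsHermitian ∧ X = Y + Z ∧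
      ∑ i, absSpecVec Y i + k * absSpecVec Z ⟨0, hn⟩ ≤ sumLargest (absSpecVec X) k := by
  obtain ⟨U, hU, d, hd, hs⟩ := exists_unitaryConj hX
  set m : Fin n := ⟨k - 1, by omega⟩
  set t : ℝ := absSpecVec X m
  have ht : 0 ≤ t := absSpecVec_nonneg hX m
  set z : Fin n → ℝ := fun i => max (-t) (min (d i) t)
  set A : Finset (Fin n) := Finset.Iic m
  have hA : A.card = k := by simp [A, m]; omega
  have hz : ∀ i, |z i| ≤ t := fun i =>
    abs_le.mpr ⟨le_max_left _ _, max_le (by linarith) (min_le_right _ _)⟩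
  have hyA : ∀ i ∈ A, |d i - z i| ≤ absSpecVec X i - t := fun i hi => by
    have h1 : t ≤ |d i| := hs i ▸ absSpecVec_antitone X (Finset.mem_Iic.mp hi)
    rw [hs]
    simp only [z]
    grind
  have hyA' : ∀ i ∉ A, |d i - z i| = 0 := fun i hi => by
    have h1 : |d i| ≤ t := hs i ▸ absSpecVec_antitone X
      (le_of_not_ge fun h => hi (Finset.mem_Iic.mpr h))
    simp only [z]
    grind
  refine ⟨unitaryConj U (d - z), unitaryConj U z, isHermitian_unitaryConj _ _,
    isHermitian_unitaryConj _ _, by rw [← unitaryConj_add, sub_add_cancel, ← hd], ?_⟩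
  have h1 : ∑ i, absSpecVec (unitaryConj U (d - z)) i ≤ ∑ i ∈ A, absSpecVec X i - k * t :=
    calc _ ≤ ∑ i, |d i - z i| := sum_absSpecVec_unitaryConj_le hU (d - z)
      _ = ∑ i ∈ A, |d i - z i| :=
        (Finset.sum_subset (Finset.subset_univ A) fun i _ hi => hyA' i hi).symm
      _ ≤ ∑ i ∈ A, (absSpecVec X i - t) := Finset.sum_le_sum hyA
      _ = _ := by simp [hA]
  have h2 : (k : ℝ) * absSpecVec (unitaryConj U z) ⟨0, hn⟩ ≤ k * t :=
    mul_le_mul_of_nonneg_left (absSpecVec_unitaryConj_le hU hz _) (Nat.cast_nonneg k)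
  have h3 := hA ▸ sum_le_sumLargest (absSpecVec X) A
  linarith

theorem sumLargest_absSpecVec_add_le (hn : 0 < n) {Y Z : Matrix (Fin n) (Fin n) ℂ}
    (hY : Y.IsHermitian) (hZ : Z.IsHermitian) {k : ℕ} (hkn : k ≤ n) :
    sumLargest (absSpecVec (Y + Z)) k ≤ ∑ i, absSpecVec Y i + k * absSpecVec Z ⟨0, hn⟩ := by
  obtain ⟨W, hW, e, he, hs⟩ := exists_unitaryConj (hY.add hZ)
  refine sumLargest_le hkn fun A hA => ?_
  calc ∑ i ∈ A, absSpecVec (Y + Z) i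
      ≤ ∑ i ∈ A, (|columnForm W Y i| + |columnForm W Z i|) := by
        refine Finset.sum_le_sum fun i _ => ?_
        rw [hs, ← columnForm_unitaryConj_self hW e i, ← he, columnForm_add]
        exact abs_add_le _ _
    _ = ∑ i ∈ A, |columnForm W Y i| + ∑ i ∈ A, |columnForm W Z i| := Finset.sum_add_distrib
    _ ≤ ∑ i, |columnForm W Y i| + ∑ i ∈ A, absSpecVec Z ⟨0, hn⟩ :=
        add_le_add
          (Finset.sum_le_sum_of_subset_of_nonneg (Finset.subset_univ A) fun _ _ _ => abs_nonneg _)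
          (Finset.sum_le_sum fun i _ => abs_columnForm_le hn hW hZ i)
    _ ≤ ∑ i, absSpecVec Y i + k * absSpecVec Z ⟨0, hn⟩ := by
        rw [Finset.sum_const, hA, nsmul_eq_mul]
        exact add_le_add_left (sum_abs_columnForm_le hW hY) _

/-- Bounds in the trace norm and in the spectral norm interpolate to all Ky Fan norms. -/
theorem sumLargest_absSpecVec_le_of_bounds (hn : 0 < n)
    {T : Matrix (Fin n) (Fin n) ℂ → Matrix (Fin n) (Fin n) ℂ}
    (hadd : ∀ X Y, T (X + Y) = T X + T Y) (hT : ∀ X, X.IsHermitian → (T X).IsHermitian)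
    {c : ℝ} (hc : 0 ≤ c)
    (hinf : ∀ X : Matrix (Fin n) (Fin n) ℂ, X.IsHermitian →
      absSpecVec (T X) ⟨0, hn⟩ ≤ c * absSpecVec X ⟨0, hn⟩)
    (hone : ∀ X : Matrix (Fin n) (Fin n) ℂ, X.IsHermitian →
      ∑ i, absSpecVec (T X) i ≤ c * ∑ i, absSpecVec X i)
    {X : Matrix (Fin n) (Fin n) ℂ} (hX : X.IsHermitian) {k : ℕ} (hk : 1 ≤ k) (hkn : k ≤ n) :
    sumLargest (absSpecVec (T X)) k ≤ c * sumLargest (absSpecVec X) k := by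
  obtain ⟨Y, Z, hY, hZ, hXYZ, h⟩ := exists_add_eq_kyFan hn hX hk hkn
  have h1 := sumLargest_absSpecVec_add_le hn (hT Y hY) (hT Z hZ) hkn
  rw [← hadd, ← hXYZ] at h1
  have h2 := mul_le_mul_of_nonneg_left (hinf Z hZ) (Nat.cast_nonneg (α := ℝ) k)
  have h3 := hone Y hY
  have h4 := mul_le_mul_of_nonneg_left h hc
  linarith

theorem mul_sumLargest_le {c : ℝ} (hc : 0 ≤ c) (p : Fin n → ℝ) {k : ℕ} (hkn : k ≤ n) :
    c * sumLargest p k ≤ sumLargest ((fun _ => c) * p) k := by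
  rcases hc.eq_or_lt with rfl | hc
  · obtain ⟨A, -, rfl⟩ := Finset.exists_subset_card_eq
      (s := (Finset.univ : Finset (Fin n))) (n := k) (by simpa using hkn)
    rw [zero_mul]
    exact (Finset.sum_eq_zero fun i _ => zero_mul (p i)).ge.trans
      (sum_le_sumLargest ((fun _ => (0 : ℝ)) * p) A)
  · rw [← le_div_iff₀' hc]
    refine sumLargest_le hkn fun A hA => ?_
    rw [le_div_iff₀' hc, Finset.mul_sum, ← hA]
    exact sum_le_sumLargest ((fun _ => c) * p) A

/-- The set of ratios `‖T X‖_∞ / ‖X‖_∞` is bounded by any operator bound of `T`. -/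
theorem normRatio_le (hn : 0 < n) {T : Matrix (Fin n) (Fin n) ℂ → Matrix (Fin n) (Fin n) ℂ}
    {c : ℝ} (h : ∀ X : Matrix (Fin n) (Fin n) ℂ, X.IsHermitian →
      absSpecVec (T X) ⟨0, hn⟩ ≤ c * absSpecVec X ⟨0, hn⟩) :
    ∀ r ∈ {r : ℝ | ∃ X : Matrix (Fin n) (Fin n) ℂ, X.IsHermitian ∧ X ≠ 0 ∧
      r = absSpecVec (T X) ⟨0, hn⟩ / absSpecVec X ⟨0, hn⟩}, r ≤ c := by
  rintro r ⟨X, hX, h0, rfl⟩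
  exact (div_le_iff₀ (absSpecVec_pos hn hX h0)).mpr (h X hX)

theorem absSpecVec_le_sSup_normRatio_mul (hn : 0 < n)
    {T : Matrix (Fin n) (Fin n) ℂ → Matrix (Fin n) (Fin n) ℂ} (hzero : T 0 = 0) {c : ℝ}
    (h : ∀ X : Matrix (Fin n) (Fin n) ℂ, X.IsHermitian →
      absSpecVec (T X) ⟨0, hn⟩ ≤ c * absSpecVec X ⟨0, hn⟩)
    {X : Matrix (Fin n) (Fin n) ℂ} (hX : X.IsHermitian) :
    absSpecVec (T X) ⟨0, hn⟩ ≤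
      sSup {r : ℝ | ∃ X : Matrix (Fin n) (Fin n) ℂ, X.IsHermitian ∧ X ≠ 0 ∧
        r = absSpecVec (T X) ⟨0, hn⟩ / absSpecVec X ⟨0, hn⟩} * absSpecVec X ⟨0, hn⟩ := by
  by_cases h0 : X = 0
  · simp [h0, hzero, absSpecVec_zero]
  · rw [← div_le_iff₀ (absSpecVec_pos hn hX h0)]
    exact le_csSup ⟨c, normRatio_le hn h⟩ ⟨X, hX, h0, rfl⟩

end AbsSpecVec

theorem least_vector_first_component_eq_norm (n : ℕ) (hn : 0 < n)
    (T T' : Matrix (Fin n) (Fin n) ℂ → Matrix (Fin n) (Fin n) ℂ)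
    (hTlin : IsLinearMap ℝ T) (hT'lin : IsLinearMap ℝ T')
    (hT : ∀ X : Matrix (Fin n) (Fin n) ℂ, X.IsHermitian → (T X).IsHermitian)
    (hT' : ∀ X : Matrix (Fin n) (Fin n) ℂ, X.IsHermitian → (T' X).IsHermitian)
    (hadj : IsAdjointOf T' T)
    (q : Fin n → ℝ) (hq : IsLeastVector T q) :
    q ⟨0, hn⟩ = max
      (sSup {r : ℝ | ∃ X : Matrix (Fin n) (Fin n) ℂ, X.IsHermitian ∧ X ≠ 0 ∧
        r = absSpecVec (T X) ⟨0, hn⟩ / absSpecVec X ⟨0, hn⟩})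
      (sSup {r : ℝ | ∃ X : Matrix (Fin n) (Fin n) ℂ, X.IsHermitian ∧ X ≠ 0 ∧
        r = absSpecVec (T' X) ⟨0, hn⟩ / absSpecVec X ⟨0, hn⟩}) := by
  obtain ⟨⟨hanti, hq0⟩, hmaj, hleast⟩ := hq
  have hqle : ∀ i, q i ≤ q ⟨0, hn⟩ := fun i => hanti (Fin.mk_le_of_le_val (Nat.zero_le _))
  have hinf : ∀ X : Matrix (Fin n) (Fin n) ℂ, X.IsHermitian →
      absSpecVec (T X) ⟨0, hn⟩ ≤ q ⟨0, hn⟩ * absSpecVec X ⟨0, hn⟩ := fun X hX =>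
    (le_sumLargest_one _ _).trans <| (hmaj X hX 1 le_rfl hn).trans <|
      sumLargest_one_le hn fun i => mul_le_mul (hqle i) (absSpecVec_le_zero_index hn X i)
        (absSpecVec_nonneg hX i) (hq0 _)
  have hone : ∀ X : Matrix (Fin n) (Fin n) ℂ, X.IsHermitian →
      ∑ i, absSpecVec (T X) i ≤ q ⟨0, hn⟩ * ∑ i, absSpecVec X i := fun X hX => by
    have h := hmaj X hX n hn le_rfl
    rw [sumLargest_card_eq_sum, sumLargest_card_eq_sum] at h
    rw [Finset.mul_sum]
    exact h.trans <| Finset.sum_le_sum fun i _ =>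
      mul_le_mul_of_nonneg_right (hqle i) (absSpecVec_nonneg hX i)
  have hinf' : ∀ X : Matrix (Fin n) (Fin n) ℂ, X.IsHermitian →
      absSpecVec (T' X) ⟨0, hn⟩ ≤ q ⟨0, hn⟩ * absSpecVec X ⟨0, hn⟩ := fun X hX =>
    absSpecVec_le_of_adjoint hn hT hT' hadj (hq0 _) hone hX
  refine le_antisymm ?_ (max_le (Real.sSup_le (normRatio_le hn hinf) (hq0 _))
    (Real.sSup_le (normRatio_le hn hinf') (hq0 _)))
  have hbound := fun X hX => absSpecVec_le_sSup_normRatio_mul hn hTlin.map_zero hinf (X := X) hX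
  have hbound' := fun X hX => absSpecVec_le_sSup_normRatio_mul hn hT'lin.map_zero hinf' (X := X) hX
  set N : ℝ := sSup {r : ℝ | ∃ X : Matrix (Fin n) (Fin n) ℂ, X.IsHermitian ∧ X ≠ 0 ∧
    r = absSpecVec (T X) ⟨0, hn⟩ / absSpecVec X ⟨0, hn⟩}
  set N' : ℝ := sSup {r : ℝ | ∃ X : Matrix (Fin n) (Fin n) ℂ, X.IsHermitian ∧ X ≠ 0 ∧
    r = absSpecVec (T' X) ⟨0, hn⟩ / absSpecVec X ⟨0, hn⟩}
  have hN0 : 0 ≤ N := by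
    refine Real.sSup_nonneg ?_
    rintro r ⟨X, hX, -, rfl⟩
    exact div_nonneg (absSpecVec_nonneg (hT X hX) _) (absSpecVec_nonneg hX _)
  have hc : 0 ≤ max N N' := hN0.trans (le_max_left _ _)
  have hinfc : ∀ X : Matrix (Fin n) (Fin n) ℂ, X.IsHermitian →
      absSpecVec (T X) ⟨0, hn⟩ ≤ max N N' * absSpecVec X ⟨0, hn⟩ := fun X hX =>
    (hbound X hX).trans <| mul_le_mul_of_nonneg_right (le_max_left _ _) (absSpecVec_nonneg hX _)
  have honec : ∀ X : Matrix (Fin n) (Fin n) ℂ, X.IsHermitian →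
      ∑ i, absSpecVec (T X) i ≤ max N N' * ∑ i, absSpecVec X i := fun X hX =>
    sum_absSpecVec_le_of_adjoint hn hT hT' hadj hc (fun Y hY => (hbound' Y hY).trans <|
      mul_le_mul_of_nonneg_right (le_max_right _ _) (absSpecVec_nonneg hY _)) hX
  have hw : WeakMaj q fun _ => max N N' := hleast _ ⟨antitone_const, fun _ => hc⟩
    fun X hX k hk hkn => (sumLargest_absSpecVec_le_of_bounds hn hTlin.map_add hT hc hinfc honec
      hX hk hkn).trans (mul_sumLargest_le hc _ hkn)
  exact (le_sumLargest_one q _).trans <| (hw 1 le_rfl hn).trans <|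
    sumLargest_one_le hn fun _ => le_rfl
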